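/- arXiv:0710.4477 — 2 statements merged into one kernel-verified Lean document; each statement's English description precedes it below -/
import Mathlib

section
/- Suppose the index set I of the type Δ has at most two elements. Then the finite maximal antichains in the homomorphism order C_Δ are exactly the sets Q = ℱ ∪ {D ∈ 𝒟 : D ↛ F for every F ∈ ℱ}, where (ℱ, 𝒟) ranges over all finite homomorphism dualities. -/
/-! Framework: finite relational structures of a fixed type Δ = (δ i : i ∈ I),
homomorphisms, cores, sums, products, exponentials, shadows, trees, forests,
duality pairs, finite dualities, transversals, antichains. -/

namespace ThesisFormal

/-- A finite relational structure of type `Δ = (δ i : i ∈ I)`: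
a finite nonempty base set together with a `δ i`-ary relation for each `i ∈ I`. -/
structure RelStruct (I : Type) (δ : I → ℕ) : Type 1 where
  carrier : Type
  finite : Finite carrier
  nonempty : Nonempty carrier
  rel : ∀ i : I, Set ((Fin (δ i)) → carrier)

namespace RelStruct

variable {I : Type} {δ : I → ℕ}

/-- `f` is a homomorphism from `A` to `B`. -/
def IsHom (A B : RelStruct I δ) (f : A.carrier → B.carrier) : Prop :=
  ∀ i : I, ∀ e ∈ A.rel i, (f ∘ e) ∈ B.rel i

/-- `A → B`: some homomorphism from `A` to `B` exists. -/
def HomTo (A B : RelStruct I δ) : Prop := ∃ f, IsHom A B f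

/-- `A ≈ B`: homomorphic equivalence. -/
def HomEquiv (A B : RelStruct I δ) : Prop := HomTo A B ∧ HomTo B A

/-- `A` and `B` are incomparable: no homomorphism either way. -/
def Incomparable (A B : RelStruct I δ) : Prop := ¬ HomTo A B ∧ ¬ HomTo B A

/-- `A ≅ B`: a bijective homomorphism whose inverse is also a homomorphism. -/
def Isomorphic (A B : RelStruct I δ) : Prop :=
  ∃ f : A.carrier ≃ B.carrier, IsHom A B f ∧ IsHom B A f.symm

/-- A retraction of `A`: an endomorphism fixing its image pointwise. -/
def IsRetraction (A : RelStruct I δ) (f : A.carrier → A.carrier) : Prop :=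
  IsHom A A f ∧ ∀ x ∈ Set.range f, f x = x

/-- A core: a structure with no proper retracts (every retraction is surjective). -/
def IsCore (A : RelStruct I δ) : Prop :=
  ∀ f, IsRetraction A f → Function.Surjective f

/-- The substructure of `A` induced by a nonempty `S ⊆ |A|`. -/
noncomputable def Substruct (A : RelStruct I δ) (S : Set A.carrier) (hS : S.Nonempty) :
    RelStruct I δ where
  carrier := S
  finite := by haveI := A.finite; exact Subtype.finite
  nonempty := hS.to_subtype
  rel i := {e | (fun j => (e j : A.carrier)) ∈ A.rel i}

/-- `C` is a retract of `A`: the substructure induced by the image of a retraction. -/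
def IsRetractOf (C A : RelStruct I δ) : Prop :=
  ∃ f, IsRetraction A f ∧
    C = A.Substruct (Set.range f) ⟨f A.nonempty.some, Set.mem_range_self _⟩

/-- The sum (disjoint union) `A + B`. -/
noncomputable def sum (A B : RelStruct I δ) : RelStruct I δ where
  carrier := A.carrier ⊕ B.carrier
  finite := by haveI := A.finite; haveI := B.finite; infer_instance
  nonempty := ⟨Sum.inl A.nonempty.some⟩
  rel i := {e | (∃ ea ∈ A.rel i, e = Sum.inl ∘ ea) ∨ (∃ eb ∈ B.rel i, e = Sum.inr ∘ eb)}

/-- The product `A × B`. -/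
noncomputable def prod (A B : RelStruct I δ) : RelStruct I δ where
  carrier := A.carrier × B.carrier
  finite := by haveI := A.finite; haveI := B.finite; infer_instance
  nonempty := ⟨(A.nonempty.some, B.nonempty.some)⟩
  rel i := {e | (fun j => (e j).1) ∈ A.rel i ∧ (fun j => (e j).2) ∈ B.rel i}

/-- The exponential structure `C ^ B`. -/
noncomputable def exp (C B : RelStruct I δ) : RelStruct I δ where
  carrier := B.carrier → C.carrier
  finite := by haveI := B.finite; haveI := C.finite; infer_instance
  nonempty := ⟨fun _ => C.nonempty.some⟩
  rel i := {f | ∀ e ∈ B.rel i, (fun j => f j (e j)) ∈ C.rel i}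

/-- The sum of a finite nonempty family of structures. -/
noncomputable def sigmaSum {J : Type} (hJfin : Finite J) (hJne : Nonempty J)
    (A : J → RelStruct I δ) : RelStruct I δ where
  carrier := Σ j, (A j).carrier
  finite := by
    haveI := hJfin
    haveI : ∀ j, Finite ((A j).carrier) := fun j => (A j).finite
    infer_instance
  nonempty := ⟨⟨hJne.some, (A hJne.some).nonempty.some⟩⟩
  rel i := {e | ∃ j, ∃ ea ∈ (A j).rel i, e = fun k => ⟨j, ea k⟩}

/-- The product of a finite family of structures. -/
noncomputable def piProd {J : Type} (hJfin : Finite J)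
    (A : J → RelStruct I δ) : RelStruct I δ where
  carrier := ∀ j, (A j).carrier
  finite := by
    haveI := hJfin
    haveI : ∀ j, Finite ((A j).carrier) := fun j => (A j).finite
    infer_instance
  nonempty := ⟨fun j => (A j).nonempty.some⟩
  rel i := {e | ∀ j, (fun k => e k j) ∈ (A j).rel i}

/-- An edge of the shadow multigraph `Sh(A)`: one edge joining `e j` and `e (j+1)`
for each edge `e ∈ R i (A)` and each `j` with `j + 1 < δ i`. -/
structure ShadowEdge (A : RelStruct I δ) : Type where
  i : I
  e : Fin (δ i) → A.carrier
  mem : e ∈ A.rel i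
  j : ℕ
  hj : j + 1 < δ i

/-- First endpoint of a shadow edge. -/
def ShadowEdge.src {A : RelStruct I δ} (s : ShadowEdge A) : A.carrier :=
  s.e ⟨s.j, Nat.lt_of_succ_lt s.hj⟩

/-- Second endpoint of a shadow edge. -/
def ShadowEdge.tgt {A : RelStruct I δ} (s : ShadowEdge A) : A.carrier :=
  s.e ⟨s.j + 1, s.hj⟩

/-- The adjacency relation of the shadow `Sh(A)`. -/
def shadowAdj (A : RelStruct I δ) (a b : A.carrier) : Prop :=
  ∃ s : ShadowEdge A, (s.src = a ∧ s.tgt = b) ∨ (s.src = b ∧ s.tgt = a)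

/-- The shadow of `A` is connected. -/
def ShadowConnected (A : RelStruct I δ) : Prop :=
  ∀ a b : A.carrier, Relation.ReflTransGen (shadowAdj A) a b

/-- `A` is a Δ-tree: its shadow multigraph is a tree, i.e. it is connected and
the number of edge occurrences is one less than the number of vertices
(this rules out cycles, loops and parallel edges). -/
def IsTreeStruct (A : RelStruct I δ) : Prop :=
  ShadowConnected A ∧ Nat.card (ShadowEdge A) + 1 = Nat.card A.carrier

/-- The number of connected components of the shadow of `A`. -/
noncomputable def numComponents (A : RelStruct I δ) : ℕ :=
  Nat.card (Quot (shadowAdj A))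

/-- `A` is a Δ-forest: every component of its shadow multigraph is a tree. -/
def IsForestStruct (A : RelStruct I δ) : Prop :=
  Nat.card (ShadowEdge A) + numComponents A = Nat.card A.carrier

/-- The component of `A` containing the vertex `a`. -/
noncomputable def componentOf (A : RelStruct I δ) (a : A.carrier) : RelStruct I δ :=
  A.Substruct {b | Relation.ReflTransGen (shadowAdj A) a b}
    ⟨a, Relation.ReflTransGen.refl⟩

/-- `(F, D)` is a duality pair: for every `A`, `F → A` iff `A ↛ D`. -/
def DualityPair (F D : RelStruct I δ) : Prop :=
  ∀ A : RelStruct I δ, HomTo F A ↔ ¬ HomTo A D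

/-- `(F, D)` is a finite homomorphism duality: `F` and `D` are finite sets of
pairwise incomparable cores and for every `X`, some member of `F` maps to `X`
iff `X` maps to no member of `D`. -/
def FiniteDuality (F D : Set (RelStruct I δ)) : Prop :=
  F.Finite ∧ D.Finite ∧
  (∀ A ∈ F, IsCore A) ∧ (∀ A ∈ D, IsCore A) ∧
  F.Pairwise Incomparable ∧ D.Pairwise Incomparable ∧
  ∀ X : RelStruct I δ, (∃ A ∈ F, HomTo A X) ↔ (∀ B ∈ D, ¬ HomTo X B)

/-- The set of connected components of `A`. -/
def componentsSet (A : RelStruct I δ) : Set (RelStruct I δ) :=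
  {C | ∃ a : A.carrier, C = componentOf A a}

/-- The set `ℱ_c` of connected components of the members of `F`. -/
def componentsOfFamily (F : Set (RelStruct I δ)) : Set (RelStruct I δ) :=
  ⋃ A ∈ F, componentsSet A

/-- A quasitransversal over `F`: a set of pairwise incomparable components of
members of `F` supporting `F`. -/
def Quasitransversal (F M : Set (RelStruct I δ)) : Prop :=
  M ⊆ componentsOfFamily F ∧ M.Pairwise Incomparable ∧
  ∀ A ∈ F, ∃ C ∈ M, HomTo C A

/-- The order on quasitransversals: `M ⪯ M'` iff every member of `M'` admits a
homomorphism from some member of `M`. -/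
def QTle (M M' : Set (RelStruct I δ)) : Prop :=
  ∀ C' ∈ M', ∃ C ∈ M, HomTo C C'

/-- A transversal: a `⪯`-maximal quasitransversal. -/
def IsTransversal (F M : Set (RelStruct I δ)) : Prop :=
  Quasitransversal F M ∧ ∀ M', Quasitransversal F M' → QTle M M' → M' = M

/-- The product of a family of structures indexed by `Fin n`. -/
noncomputable def finProd (n : ℕ) (A : Fin n → RelStruct I δ) : RelStruct I δ :=
  piProd (inferInstance : Finite (Fin n)) A

/-- `D` is (isomorphic to) `D(M)`, the core of the product of the duals `D(C)`
of the members `C` of the finite set `M`. -/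
def IsSetDual (M : Set (RelStruct I δ)) (D : RelStruct I δ) : Prop :=
  IsCore D ∧ ∃ (n : ℕ) (C DC : Fin n → RelStruct I δ),
    Function.Injective C ∧ Set.range C = M ∧
    (∀ k, IsCore (DC k) ∧ DualityPair (C k) (DC k)) ∧
    HomEquiv D (finProd n DC)

/-- `D` is the result (up to isomorphism) of the transversal construction on `F`:
its members are exactly the duals of the transversals over `F`, one for each
transversal. -/
def TransversalDualSet (F D : Set (RelStruct I δ)) : Prop :=
  (∀ d ∈ D, ∃ M, IsTransversal F M ∧ IsSetDual M d) ∧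
  (∀ M, IsTransversal F M → ∃ d ∈ D, IsSetDual M d) ∧
  (∀ d ∈ D, ∀ d' ∈ D, ∀ M : Set (RelStruct I δ),
    IsSetDual M d → IsSetDual M d' → d = d')

/-- `Q` is a maximal antichain in the homomorphism order: a set of pairwise
incomparable cores such that every structure is comparable with some member. -/
def IsMaxAntichain (Q : Set (RelStruct I δ)) : Prop :=
  (∀ A ∈ Q, IsCore A) ∧ Q.Pairwise Incomparable ∧
  ∀ X : RelStruct I δ, ∃ A ∈ Q, HomTo X A ∨ HomTo A X

/-- The maximal antichain `Q` splits. -/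
def Splits (Q : Set (RelStruct I δ)) : Prop :=
  ∃ Q₁ Q₂ : Set (RelStruct I δ), Q₁ ∪ Q₂ = Q ∧ Disjoint Q₁ Q₂ ∧
    ∀ X : RelStruct I δ, (∃ A ∈ Q₁, HomTo A X) ∨ (∃ B ∈ Q₂, HomTo X B)

/-- `A < B` in the homomorphism order. -/
def StrictHom (A B : RelStruct I δ) : Prop := HomTo A B ∧ ¬ HomTo B A

/-- (The homomorphic-equivalence class of) `Y` is a cutting point in the
homomorphism order. -/
def CuttingPoint (Y : RelStruct I δ) : Prop :=
  ∃ X Z : RelStruct I δ, StrictHom X Y ∧ StrictHom Y Z ∧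
    ∀ W : RelStruct I δ, HomTo X W → HomTo W Z → (HomTo W Y ∨ HomTo Y W)

/-- `A` has at most one edge of each kind. -/
def AtMostOneEdgePerKind (A : RelStruct I δ) : Prop :=
  ∀ i : I, ∀ e ∈ A.rel i, ∀ e' ∈ A.rel i, e = e'

end RelStruct

end ThesisFormal

namespace ThesisFormal

namespace RelStruct

variable {I : Type} {δ : I → ℕ}

/-! ### The homomorphism preorder and cores -/

theorem HomTo.refl (A : RelStruct I δ) : HomTo A A :=
  ⟨id, fun _ _ he => he⟩

theorem HomTo.trans {A B C : RelStruct I δ} (h : HomTo A B) (h' : HomTo B C) : HomTo A C := by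
  obtain ⟨f, hf⟩ := h
  obtain ⟨g, hg⟩ := h'
  exact ⟨g ∘ f, fun i e he => hg i _ (hf i e he)⟩

theorem HomEquiv.trans {A B C : RelStruct I δ} (h : HomEquiv A B) (h' : HomEquiv B C) :
    HomEquiv A C :=
  ⟨h.1.trans h'.1, h'.2.trans h.2⟩

theorem homEquiv_substruct_range {A : RelStruct I δ} {f : A.carrier → A.carrier}
    (hf : IsRetraction A f) (hne : (Set.range f).Nonempty) :
    HomEquiv A (A.Substruct (Set.range f) hne) :=
  ⟨⟨fun a => ⟨f a, a, rfl⟩, fun i e he => hf.1 i e he⟩, ⟨Subtype.val, fun _ _ he => he⟩⟩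

theorem exists_isCore_homEquiv (A : RelStruct I δ) : ∃ C, IsCore C ∧ HomEquiv A C := by
  classical
  have hex : ∃ n, ∃ C : RelStruct I δ, HomEquiv A C ∧ Nat.card C.carrier = n :=
    ⟨_, A, ⟨HomTo.refl A, HomTo.refl A⟩, rfl⟩
  obtain ⟨C, hAC, hcard⟩ := Nat.find_spec hex
  refine ⟨C, fun f hf => ?_, hAC⟩
  by_contra hsurj
  have hne : (Set.range f).Nonempty := ⟨f C.nonempty.some, Set.mem_range_self _⟩
  have hmin := Nat.find_min' hex
    ⟨C.Substruct _ hne, hAC.trans (homEquiv_substruct_range hf hne), rfl⟩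
  rw [← hcard] at hmin
  have := C.finite
  have hlt : (Set.range f).ncard < Nat.card C.carrier := by
    rw [← Set.ncard_univ]
    exact Set.ncard_lt_ncard (Set.ssubset_univ_iff.2 fun h => hsurj (Set.range_eq_univ.1 h))
  exact absurd hmin (not_le.2 hlt)

/-- Every finite family contains an antichain of members that dominates the whole family. -/
theorem exists_dominating_antichain {S : Set (RelStruct I δ)} (hS : S.Finite) :
    ∃ D ⊆ S, D.Pairwise Incomparable ∧ ∀ s ∈ S, ∃ d ∈ D, HomTo s d := by
  induction S, hS using Set.Finite.induction_on with
  | empty => exact ⟨∅, subset_rfl, Set.pairwise_empty _, by simp⟩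
  | @insert a S _ _ ih =>
    obtain ⟨D, hDS, hD, hdom⟩ := ih
    by_cases ha : ∃ d ∈ D, HomTo a d
    · refine ⟨D, hDS.trans (Set.subset_insert _ _), hD, ?_⟩
      rintro s (rfl | hs)
      exacts [ha, hdom s hs]
    · push Not at ha
      refine ⟨insert a {d ∈ D | ¬ HomTo d a}, ?_, ?_, ?_⟩
      · exact Set.insert_subset_insert fun d hd => hDS hd.1
      · refine (hD.mono fun d hd => hd.1).insert fun d hd _ => ?_
        exact ⟨⟨ha d hd.1, hd.2⟩, ⟨hd.2, ha d hd.1⟩⟩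
      · rintro s (rfl | hs)
        · exact ⟨s, Set.mem_insert _ _, HomTo.refl s⟩
        · obtain ⟨d, hd, hsd⟩ := hdom s hs
          by_cases hda : HomTo d a
          · exact ⟨a, Set.mem_insert _ _, hsd.trans hda⟩
          · exact ⟨d, Set.mem_insert_of_mem _ ⟨hd, hda⟩, hsd⟩

/-! ### Maximal antichains and dualities -/

theorem isMaxAntichain_of_finiteDuality {F D : Set (RelStruct I δ)} (h : FiniteDuality F D) :
    (F ∪ {d ∈ D | ∀ f ∈ F, ¬ HomTo d f}).Finite ∧
      IsMaxAntichain (F ∪ {d ∈ D | ∀ f ∈ F, ¬ HomTo d f}) := by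
  obtain ⟨hF, hD, hFc, hDc, hFa, hDa, hdual⟩ := h
  have hFD : ∀ f ∈ F, ∀ d ∈ D, ¬ HomTo f d := fun f hf => (hdual f).1 ⟨f, hf, HomTo.refl f⟩
  refine ⟨hF.union (hD.subset fun d hd => hd.1), ?_, ?_, fun X => ?_⟩
  · rintro A (hA | hA)
    exacts [hFc A hA, hDc A hA.1]
  · rintro A (hA | hA) B (hB | hB) hne
    · exact hFa hA hB hne
    · exact ⟨hFD A hA B hB.1, hB.2 A hA⟩
    · exact ⟨hA.2 B hB, hFD B hB A hA.1⟩
    · exact hDa hA.1 hB.1 hne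
  · by_cases hX : ∃ f ∈ F, HomTo f X
    · obtain ⟨f, hf, hfX⟩ := hX
      exact ⟨f, Or.inl hf, Or.inr hfX⟩
    · rw [hdual X] at hX
      push Not at hX
      obtain ⟨d, hd, hXd⟩ := hX
      by_cases hdF : ∀ f ∈ F, ¬ HomTo d f
      · exact ⟨d, Or.inr ⟨hd, hdF⟩, Or.inl hXd⟩
      · push Not at hdF
        obtain ⟨f, hf, hdf⟩ := hdF
        exact ⟨f, Or.inl hf, Or.inl (hXd.trans hdf)⟩

theorem IsMaxAntichain.eq_of_homTo {Q : Set (RelStruct I δ)} (hQ : IsMaxAntichain Q)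
    {A B : RelStruct I δ} (hA : A ∈ Q) (hB : B ∈ Q) (h : HomTo A B) : A = B := by
  by_contra hne
  exact (hQ.2.1 hA hB hne).1 h

/-- A finite maximal antichain arises from a duality as soon as it has a part `Q'` such that
everything outside the down-set of `Q` lies above some member of `Q \ Q'`, and the structures
strictly below members of `Q \ Q'` but not below `Q'` form finitely many equivalence classes. -/
theorem IsMaxAntichain.exists_finiteDuality {Q Q' L : Set (RelStruct I δ)} (hfin : Q.Finite)
    (hQ : IsMaxAntichain Q) (hQ' : Q' ⊆ Q) (hL : L.Finite)
    (hup : ∀ X, (∀ A ∈ Q, ¬ HomTo X A) → ∃ A ∈ Q \ Q', HomTo A X)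
    (hdown : ∀ X, ∀ f ∈ Q \ Q', StrictHom X f →
      (∃ A ∈ Q', HomTo X A) ∨ ∃ y ∈ L, HomEquiv X y) :
    ∃ F D : Set (RelStruct I δ), FiniteDuality F D ∧
      Q = F ∪ {d ∈ D | ∀ f ∈ F, ¬ HomTo d f} := by
  choose core hcore hequiv using exists_isCore_homEquiv (I := I) (δ := δ)
  set L' : Set (RelStruct I δ) := core '' {y ∈ L | ∃ f ∈ Q \ Q', StrictHom y f} with hL'
  have hL'lt : ∀ y ∈ L', ∃ f ∈ Q \ Q', StrictHom y f := by
    rintro _ ⟨y, ⟨_, f, hf, hyf, hfy⟩, rfl⟩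
    exact ⟨f, hf, (hequiv y).2.trans hyf, fun h => hfy (h.trans (hequiv y).2)⟩
  have hL'fin : L'.Finite := (hL.subset fun y hy => hy.1).image core
  obtain ⟨D, hDS, hDa, hdom⟩ := exists_dominating_antichain ((hfin.subset hQ').union hL'fin)
  have hQ'D : Q' ⊆ D := by
    intro q hq
    obtain ⟨d, hd, hqd⟩ := hdom q (Or.inl hq)
    rcases hDS hd with hd' | hd'
    · rwa [hQ.eq_of_homTo (hQ' hq) (hQ' hd') hqd]
    · obtain ⟨f, hf, hdf, hfd⟩ := hL'lt d hd'
      have := hQ.eq_of_homTo (hQ' hq) hf.1 (hqd.trans hdf)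
      exact absurd (this ▸ hq) hf.2
  have hFD : ∀ f ∈ Q \ Q', ∀ d ∈ D, ¬ HomTo f d := by
    intro f hf d hd hfd
    rcases hDS hd with hd' | hd'
    · exact hf.2 (hQ.eq_of_homTo hf.1 (hQ' hd') hfd ▸ hd')
    · obtain ⟨g, hg, hdg, hgd⟩ := hL'lt d hd'
      have := hQ.eq_of_homTo hf.1 hg.1 (hfd.trans hdg)
      exact hgd (this ▸ hfd)
  refine ⟨Q \ Q', D, ⟨hfin.subset Set.sdiff_subset,
    ((hfin.subset hQ').union hL'fin).subset hDS, fun A hA => hQ.1 A hA.1, ?_,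
    hQ.2.1.mono Set.sdiff_subset, hDa, fun X => ⟨?_, fun hX => ?_⟩⟩, ?_⟩
  · intro A hA
    rcases hDS hA with hA | ⟨y, _, rfl⟩
    exacts [hQ.1 A (hQ' hA), hcore y]
  · rintro ⟨A, hA, hAX⟩ d hd hXd
    exact hFD A hA d hd (hAX.trans hXd)
  · by_contra hno
    have hXQ : ∃ A ∈ Q, HomTo X A := by
      by_contra h
      push Not at h
      exact hno (hup X h)
    obtain ⟨A, hA, hXA⟩ := hXQ
    by_cases hA' : A ∈ Q'
    · exact hX A (hQ'D hA') hXA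
    · have hAX : ¬ HomTo A X := fun h => hno ⟨A, ⟨hA, hA'⟩, h⟩
      rcases hdown X A ⟨hA, hA'⟩ ⟨hXA, hAX⟩ with ⟨B, hB, hXB⟩ | ⟨y, hy, hXy⟩
      · exact hX B (hQ'D hB) hXB
      · have hmem : core y ∈ L' :=
          ⟨y, ⟨hy, A, ⟨hA, hA'⟩, hXy.2.trans hXA, fun h => hAX (h.trans hXy.2)⟩, rfl⟩
        obtain ⟨d, hd, hyd⟩ := hdom _ (Or.inr hmem)
        exact hX d hd ((hXy.1.trans (hequiv y).1).trans hyd)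
  · ext A
    constructor
    · intro hA
      by_cases hA' : A ∈ Q'
      · exact Or.inr ⟨hQ'D hA', fun f hf h => hf.2 (hQ.eq_of_homTo hA hf.1 h ▸ hA')⟩
      · exact Or.inl ⟨hA, hA'⟩
    · rintro (hA | ⟨hA, hAF⟩)
      · exact hA.1
      · rcases hDS hA with hA' | hA'
        · exact hQ' hA'
        · obtain ⟨f, hf, hAf, _⟩ := hL'lt A hA'
          exact absurd hAf (hAF f hf)

/-! ### Homogeneous sets for growing families of colourings -/

/-- If every `c N` colours the finite sets of natural numbers by the same finite set of colours,
then for arbitrarily large `N` there is a set of any prescribed cardinality below `N` all of whose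
`k`-subsets have the same colour with respect to `c N`. -/
theorem exists_homogeneous_finset {C : Type*} [Finite C] (c : ℕ → Finset ℕ → C) (k m : ℕ) :
    ∃ N, ∃ S : Finset ℕ, S.card = m ∧ (∀ x ∈ S, x < N) ∧
      ∃ b, ∀ t ⊆ S, t.card = k → c N t = b := by
  classical
  have hlim : ∀ f : ℕ → C, ∃ b, ∀ᶠ n in (Filter.hyperfilter ℕ : Filter ℕ), f n = b := by
    intro f
    obtain ⟨b, hb⟩ := Ultrafilter.eq_pure_of_finite ((Filter.hyperfilter ℕ).map f)
    refine ⟨b, ?_⟩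
    have : ({b} : Set C) ∈ (Filter.hyperfilter ℕ).map f := by rw [hb]; rfl
    exact this
  choose lim hlim using hlim
  let D : ℕ → Finset ℕ → C := fun j => Nat.rec (fun t => lim fun N => c N t)
    (fun _ Dj t => lim fun y => Dj (insert y t)) j
  have hD0 : ∀ t, ∀ᶠ N in (Filter.hyperfilter ℕ : Filter ℕ), c N t = D 0 t := fun t => hlim _
  have hD : ∀ j t, ∀ᶠ y in (Filter.hyperfilter ℕ : Filter ℕ), D j (insert y t) = D (j + 1) t :=
    fun j t => hlim _
  have hlarge : ∀ n : ℕ, ∀ᶠ y in (Filter.hyperfilter ℕ : Filter ℕ), n ≤ y := by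
    intro n
    have : Filter.Tendsto id (Filter.hyperfilter ℕ : Filter ℕ) Filter.atTop := by
      rw [← Nat.cofinite_eq_atTop]
      exact Filter.hyperfilter_le_cofinite
    exact this.eventually_ge_atTop n
  have hS : ∃ S : Finset ℕ, S.card = m ∧
      ∀ t ⊆ S, ∀ j, t.card + j = k → D j t = D k ∅ := by
    induction m with
    | zero =>
      refine ⟨∅, rfl, fun t ht j hj => ?_⟩
      obtain rfl := Finset.subset_empty.1 ht
      simp only [Finset.card_empty, zero_add] at hj
      rw [hj]
    | succ m ih =>
      obtain ⟨S, hcard, hS⟩ := ih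
      have hall : ∀ᶠ y in (Filter.hyperfilter ℕ : Filter ℕ), ∀ t ∈ S.powerset,
          ∀ j ∈ Finset.range k, D j (insert y t) = D (j + 1) t := by
        rw [Filter.eventually_all_finset]
        intro t _
        rw [Filter.eventually_all_finset]
        exact fun j _ => hD j t
      obtain ⟨y, hy, hyS⟩ := (hall.and (hlarge (S.sup id + 1))).exists
      have hyn : y ∉ S := fun h => by
        exact lt_irrefl y ((Finset.le_sup (f := id) h).trans_lt hyS)
      refine ⟨insert y S, by rw [Finset.card_insert_of_notMem hyn, hcard], fun t ht j hj => ?_⟩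
      by_cases hyt : y ∈ t
      · have hsub : t.erase y ⊆ S := by
          rw [← Finset.erase_insert hyn]
          exact Finset.erase_subset_erase y ht
        have hc := Finset.card_erase_add_one hyt
        have hjk : j < k := by omega
        have h := hy _ (Finset.mem_powerset.2 hsub) j (Finset.mem_range.2 hjk)
        rw [Finset.insert_erase hyt] at h
        rw [h]
        exact hS _ hsub (j + 1) (by omega)
      · exact hS t ((Finset.subset_insert_iff_of_notMem hyt).1 ht) j hj
  obtain ⟨S, hcard, hS⟩ := hS
  have hall : ∀ᶠ N in (Filter.hyperfilter ℕ : Filter ℕ), ∀ t ∈ S.powerset, c N t = D 0 t := by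
    rw [Filter.eventually_all_finset]
    exact fun t _ => hD0 t
  obtain ⟨N, hN, hNS⟩ := (hall.and (hlarge (S.sup id + 1))).exists
  refine ⟨N, S, hcard, fun x hx => ?_, D k ∅, fun t ht htk => ?_⟩
  · exact (Finset.le_sup (f := id) hx).trans_lt hNS
  · rw [hN t (Finset.mem_powerset.2 ht)]
    exact hS t ht 0 (by omega)

/-! ### Generalised shift structures -/

/-- The generalised shift structure: vertices are words of length `2 * M + 1` over an alphabet with
`n + 1` letters, and the entries of an edge of kind `i` are the windows with offsets `w ⟨i, r⟩` of
an injective word of length `3 * M + 1`. -/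
def shift (w : (Σ i, Fin (δ i)) → ℕ) (M n : ℕ) : RelStruct I δ where
  carrier := Fin (2 * M + 1) → Fin (n + 1)
  finite := inferInstance
  nonempty := ⟨fun _ => 0⟩
  rel i := {e | ∃ s : ℕ → Fin (n + 1), Set.InjOn s (Set.Iio (3 * M + 1)) ∧
    ∀ r a, e r a = s (a + w ⟨i, r⟩)}

theorem exists_prod_shift_not_homTo {w : (Σ i, Fin (δ i)) → ℕ} {M : ℕ} (hw : ∀ a, w a ≤ M)
    {Q : Set (RelStruct I δ)} (hQ : Q.Finite) {X : RelStruct I δ} (hX : ∀ B ∈ Q, ¬ HomTo X B) :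
    ∃ n, ∀ B ∈ Q, ¬ HomTo (X.prod (shift w M n)) B := by
  classical
  by_contra! hcon
  choose B hBQ hB using hcon
  choose f hf using hB
  have := hQ.to_subtype
  have := X.finite
  have : ∀ B : Q, Finite B.1.carrier := fun B => B.1.finite
  let word : ℕ → Finset ℕ → Fin (2 * M + 1) → ℕ := fun N t a =>
    if h : t.card = 2 * M + 1 then t.orderEmbOfFin h a else 0
  let c : ℕ → Finset ℕ → Σ B : Q, X.carrier → B.1.carrier := fun N t =>
    ⟨⟨B N, hBQ N⟩, fun x => f N (x, fun a => Fin.ofNat (N + 1) (word N t a))⟩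
  obtain ⟨N, S, hS, hSN, b, hb⟩ := exists_homogeneous_finset c (2 * M + 1) (3 * M + 1)
  let s : ℕ → ℕ := fun k => if h : k < 3 * M + 1 then S.orderEmbOfFin hS ⟨k, h⟩ else 0
  have hs : StrictMonoOn s (Set.Iio (3 * M + 1)) := by
    intro x hx y hy hxy
    simp only [Set.mem_Iio] at hx hy
    simp only [s, hx, hy, dite_true]
    exact (S.orderEmbOfFin hS).strictMono hxy
  have hsS : ∀ k < 3 * M + 1, s k ∈ S := by
    intro k hk
    simp only [s, hk, dite_true]
    exact Finset.orderEmbOfFin_mem _ _ _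
  let win : ℕ → Finset ℕ := fun o => Finset.univ.image fun a : Fin (2 * M + 1) => s (a + o)
  have hmono : ∀ o ≤ M, StrictMono fun a : Fin (2 * M + 1) => s (a + o) := by
    intro o ho x y hxy
    have hxy : (x : ℕ) < y := hxy
    have := x.2
    have := y.2
    exact hs (Set.mem_Iio.2 (by omega)) (Set.mem_Iio.2 (by omega)) (by omega)
  have hwcard : ∀ o ≤ M, (win o).card = 2 * M + 1 := by
    intro o ho
    rw [Finset.card_image_of_injective _ (hmono o ho).injective, Finset.card_univ,
      Fintype.card_fin]
  have hwsub : ∀ o ≤ M, win o ⊆ S := by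
    intro o ho x hx
    obtain ⟨a, -, rfl⟩ := Finset.mem_image.1 hx
    have := a.2
    exact hsS _ (by omega)
  have hword : ∀ o ≤ M, ∀ a, word N (win o) a = s (a + o) := by
    intro o ho a
    simp only [word, hwcard o ho, dite_true]
    exact (congrFun (Finset.orderEmbOfFin_unique (hwcard o ho)
      (fun a => Finset.mem_image_of_mem _ (Finset.mem_univ a)) (hmono o ho)) a).symm
  have hconst : ∀ o ≤ M, ∀ x : X.carrier,
      f N (x, fun a => Fin.ofNat (N + 1) (s (a + o))) =
        f N (x, fun a => Fin.ofNat (N + 1) (word N (win 0) a)) := by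
    intro o ho x
    have h := (hb _ (hwsub o ho) (hwcard o ho)).trans
      (hb _ (hwsub 0 M.zero_le) (hwcard 0 M.zero_le)).symm
    simp only [c, Sigma.mk.injEq, heq_eq_eq, true_and] at h
    have h := congrFun h x
    simp only [hword o ho] at h
    exact h
  refine hX _ (hBQ N) ⟨fun x => f N (x, fun a => Fin.ofNat (N + 1) (word N (win 0) a)),
    fun i e he => ?_⟩
  have hedge := hf N i (fun r => (e r, fun a => Fin.ofNat (N + 1) (s (a + w ⟨i, r⟩))))
    ⟨he, fun k => Fin.ofNat (N + 1) (s k), fun x hx y hy hxy => ?_, fun r a => rfl⟩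
  · convert hedge using 1
    funext r
    exact (hconst _ (hw _) _).symm
  · refine hs.injOn hx hy ?_
    have h1 := hSN _ (hsS x hx)
    have h2 := hSN _ (hsS y hy)
    have h3 := congrArg Fin.val hxy
    simp only [Fin.val_ofNat] at h3
    rwa [Nat.mod_eq_of_lt (by omega), Nat.mod_eq_of_lt (by omega)] at h3

/-! ### Twisted ladders -/

/-- Entry `p` of some edge of kind `i` coincides with entry `q` of some edge of kind `j`. -/
def Touch (A : RelStruct I δ) (i : I) (p : Fin (δ i)) (j : I) (q : Fin (δ j)) : Prop :=
  ∃ e ∈ A.rel i, ∃ e' ∈ A.rel j, e p = e' q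

/-- Two kinds of edges with two positions selected in each of them. -/
structure Datum (δ : I → ℕ) where
  i : I
  j : I
  p : Fin (δ i)
  p' : Fin (δ i)
  q : Fin (δ j)
  q' : Fin (δ j)

/-- The displacements of the selected positions differ. -/
def Datum.IsUnbalanced (w : (Σ i, Fin (δ i)) → ℕ) (d : Datum δ) : Prop :=
  w ⟨d.i, d.p⟩ + w ⟨d.j, d.q'⟩ ≠ w ⟨d.j, d.q⟩ + w ⟨d.i, d.p'⟩

/-- Both pairs of selected positions touch in `A`. -/
def Datum.OccursIn (d : Datum δ) (A : RelStruct I δ) : Prop :=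
  Touch A d.i d.p d.j d.q ∧ Touch A d.i d.p' d.j d.q'

/-- The identification of the two strands of a twisted ladder at its bottom and at its top. -/
def ladderGlue (N : ℕ) (d : Datum δ) (l : Fin (N + 1)) :
    Fin (δ d.i) ⊕ Fin (δ d.j) → Fin (N + 1) × (Fin (δ d.i) ⊕ Fin (δ d.j))
  | Sum.inl r => (l, Sum.inl r)
  | Sum.inr r =>
    if l = 0 ∧ r = d.q then (0, Sum.inl d.p)
    else if l = Fin.last N ∧ r = d.q' then (Fin.last N, Sum.inl d.p')
    else (l, Sum.inr r)

/-- The edges of a twisted ladder: each of them belongs to one of the two strands and its entries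
lie on two consecutive levels. -/
inductive LadderEdge (N : ℕ) (d : Datum δ) :
    ∀ i, (Fin (δ i) → Fin (N + 1) × (Fin (δ d.i) ⊕ Fin (δ d.j))) → Prop
  | left (s : ℕ) (lev : Fin (δ d.i) → Fin (N + 1))
      (h : ∀ r, (lev r : ℕ) = s ∨ (lev r : ℕ) = s + 1) :
      LadderEdge N d d.i fun r => ladderGlue N d (lev r) (Sum.inl r)
  | right (s : ℕ) (lev : Fin (δ d.j) → Fin (N + 1))
      (h : ∀ r, (lev r : ℕ) = s ∨ (lev r : ℕ) = s + 1) :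
      LadderEdge N d d.j fun r => ladderGlue N d (lev r) (Sum.inr r)

/-- The twisted ladder with levels `0, …, N`: two strands of edges of kinds `d.i` and `d.j`, glued
at the bottom along the positions `d.p`, `d.q` and at the top along the positions `d.p'`, `d.q'`. -/
def ladder (N : ℕ) (d : Datum δ) : RelStruct I δ where
  carrier := Fin (N + 1) × (Fin (δ d.i) ⊕ Fin (δ d.j))
  finite := inferInstance
  nonempty := ⟨(0, Sum.inl d.p)⟩
  rel i := {e | LadderEdge N d i e}

theorem ladderGlue_fst {N : ℕ} (d : Datum δ) (l : Fin (N + 1)) (a : Fin (δ d.i) ⊕ Fin (δ d.j)) :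
    (ladderGlue N d l a).1 = l := by
  rcases a with r | r
  · rfl
  · simp only [ladderGlue]
    split_ifs with h h'
    · exact h.1.symm
    · exact h'.1.symm
    · rfl

/-- A structure that maps to `x + ladder N d` and misses an inner level of the ladder maps to `x`
already, provided that `d` occurs in `x`. -/
theorem homTo_of_homTo_sum_ladder {A x : RelStruct I δ} {N : ℕ} {d : Datum δ}
    (hA : Nat.card A.carrier < N) (hd : d.OccursIn x) (h : HomTo A (x.sum (ladder N d))) :
    HomTo A x := by
  classical
  obtain ⟨f, hf⟩ := h
  obtain ⟨⟨e₁, he₁, e₂, he₂, he⟩, ⟨e₁', he₁', e₂', he₂', he'⟩⟩ := hd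
  obtain ⟨m, hm0, hmN, hm⟩ : ∃ m, 0 < m ∧ m ≤ N ∧
      ∀ a, ∀ v : (ladder N d).carrier, f a = Sum.inr v → (v.1 : ℕ) ≠ m := by
    by_contra! hcon
    have := A.nonempty
    have := (ladder N d).nonempty
    have := A.finite
    choose! a v hav hv using hcon
    have hinj : Function.Injective fun m : Fin N => a (m + 1) := by
      intro m m' hmm
      have h1 := hav (m + 1) (by omega) (by omega)
      have h2 := hav (m' + 1) (by omega) (by omega)
      have h3 := hv (m + 1) (by omega) (by omega)
      have h4 := hv (m' + 1) (by omega) (by omega)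
      simp only at hmm
      rw [hmm, h2] at h1
      rw [← Sum.inr_injective h1, h4] at h3
      exact Fin.ext (by omega)
    have := Nat.card_le_card_of_injective _ hinj
    rw [Nat.card_fin] at this
    omega
  let G : Fin (N + 1) → Fin (δ d.i) ⊕ Fin (δ d.j) → x.carrier := fun l a =>
    if (l : ℕ) < m then Sum.elim e₁ e₂ a else Sum.elim e₁' e₂' a
  have hG : ∀ l a, G (ladderGlue N d l a).1 (ladderGlue N d l a).2 = G l a := by
    rintro l (r | r)
    · rfl
    · simp only [ladderGlue]
      split_ifs with h h'
      · obtain ⟨rfl, rfl⟩ := h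
        simp [G, hm0, he]
      · obtain ⟨rfl, rfl⟩ := h'
        simp [G, hmN.not_gt, he']
      · rfl
  refine ⟨fun a => Sum.elim id (fun v : (ladder N d).carrier => G v.1 v.2) (f a),
    fun i e hei => ?_⟩
  rcases hf i e hei with ⟨ea, hea, heq⟩ | ⟨eb, heb, heq⟩
  · convert hea using 1
    funext r
    have := congrFun heq r
    simp only [Function.comp] at this ⊢
    rw [this]
    rfl
  · have hval : ∀ r, f (e r) = Sum.inr (eb r) := congrFun heq
    have hlev : ∀ r, ((eb r).1 : ℕ) ≠ m := fun r => hm _ _ (hval r)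
    have hgoal : (fun r => G (eb r).1 (eb r).2) ∈ x.rel i := by
      clear hval heq hei e
      cases heb with
      | left s lev h =>
        simp only [hG]
        simp only [ladderGlue_fst] at hlev
        by_cases hs : s < m
        · convert he₁ using 1
          funext r
          have : (lev r : ℕ) < m := by have := h r; have := hlev r; omega
          simp [G, this]
        · convert he₁' using 1
          funext r
          have : ¬ (lev r : ℕ) < m := by have := h r; omega
          simp [G, this]
      | right s lev h =>
        simp only [hG]
        simp only [ladderGlue_fst] at hlev
        by_cases hs : s < m
        · convert he₂ using 1
          funext r
          have : (lev r : ℕ) < m := by have := h r; have := hlev r; omega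
          simp [G, this]
        · convert he₂' using 1
          funext r
          have : ¬ (lev r : ℕ) < m := by have := h r; omega
          simp [G, this]
    convert hgoal using 1
    funext r
    simp only [Function.comp, hval]
    rfl

/-- Along a strand of a ladder mapped to a shift structure, a fixed letter of the words moves
according to the offsets. -/
theorem strand_shift {w : (Σ i, Fin (δ i)) → ℕ} {M n N : ℕ} (hw : ∀ a, w a ≤ M) {i : I}
    (hi : 2 ≤ δ i) (g : Fin (N + 1) → Fin (δ i) → (shift w M n).carrier)
    (hg : ∀ s : ℕ, ∀ lev : Fin (δ i) → Fin (N + 1),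
      (∀ r, (lev r : ℕ) = s ∨ (lev r : ℕ) = s + 1) →
        (fun r => g (lev r) r) ∈ (shift w M n).rel i)
    (p : Fin (δ i)) (l : Fin (N + 1)) (r : Fin (δ i)) :
    g l r (Fin.ofNat _ (M + w ⟨i, p⟩ - w ⟨i, r⟩)) = g 0 p (Fin.ofNat _ M) := by
  classical
  have hsame : ∀ s : ℕ, ∀ lev : Fin (δ i) → Fin (N + 1),
      (∀ r, (lev r : ℕ) = s ∨ (lev r : ℕ) = s + 1) → ∀ r r',
      g (lev r) r (Fin.ofNat _ (M + w ⟨i, p⟩ - w ⟨i, r⟩)) =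
        g (lev r') r' (Fin.ofNat _ (M + w ⟨i, p⟩ - w ⟨i, r'⟩)) := by
    intro s lev hlev r r'
    obtain ⟨t, -, ht⟩ := hg s lev hlev
    have hidx : ∀ r, g (lev r) r (Fin.ofNat _ (M + w ⟨i, p⟩ - w ⟨i, r⟩)) = t (M + w ⟨i, p⟩) := by
      intro r
      have h1 := hw ⟨i, p⟩
      have h2 := hw ⟨i, r⟩
      refine (ht r _).trans ?_
      rw [Fin.val_ofNat, Nat.mod_eq_of_lt (by omega)]
      congr 1
      omega
    rw [hidx, hidx]
  have hbase : ∀ r, g 0 r (Fin.ofNat _ (M + w ⟨i, p⟩ - w ⟨i, r⟩)) = g 0 p (Fin.ofNat _ M) := by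
    intro r
    have := hsame 0 (fun _ => 0) (fun _ => Or.inl rfl) r p
    rwa [Nat.add_sub_cancel] at this
  induction l using Fin.induction generalizing r with
  | zero => exact hbase r
  | succ l ih =>
    have : Nontrivial (Fin (δ i)) := Fin.nontrivial_iff_two_le.2 hi
    obtain ⟨r', hr'⟩ := exists_ne r
    have := hsame l (fun a => if a = r then l.succ else l.castSucc)
      (fun a => by by_cases ha : a = r <;> simp [ha]) r r'
    simp only [if_true, hr', if_false] at this
    rw [this, ih]

theorem not_homTo_ladder_shift {w : (Σ i, Fin (δ i)) → ℕ} {M : ℕ} (hw : ∀ a, w a ≤ M)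
    (hδ : ∀ i, 2 ≤ δ i) {d : Datum δ} (hd : d.IsUnbalanced w) {N : ℕ} (hN : 0 < N) (n : ℕ) :
    ¬ HomTo (ladder N d) (shift w M n) := by
  rintro ⟨g, hg⟩
  have hl := fun s lev h => hg d.i _ (LadderEdge.left s lev h)
  have hr := fun s lev h => hg d.j _ (LadderEdge.right s lev h)
  have h1 := strand_shift hw (hδ d.i) (fun l r => g (ladderGlue N d l (Sum.inl r))) hl d.p
    (Fin.last N) d.p'
  have h2 := strand_shift hw (hδ d.j) (fun l r => g (ladderGlue N d l (Sum.inr r))) hr d.q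
    (Fin.last N) d.q'
  obtain ⟨t, ht, htg⟩ := hl N (fun _ => Fin.last N) fun _ => Or.inl rfl
  have hbot : ladderGlue N d 0 (Sum.inr d.q) = ladderGlue N d 0 (Sum.inl d.p) := by
    simp [ladderGlue]
  have htop : ladderGlue N d (Fin.last N) (Sum.inr d.q') =
      ladderGlue N d (Fin.last N) (Sum.inl d.p') := by
    have : Fin.last N ≠ 0 := fun h => by
      have := congrArg Fin.val h
      simp at this
      omega
    simp [ladderGlue, this]
  simp only [hbot, htop] at h2
  have h3 := h1.trans h2.symm
  have htg' := htg d.p'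
  simp only [Function.comp] at htg'
  rw [htg', htg'] at h3
  have b1 := hw ⟨d.i, d.p⟩
  have b2 := hw ⟨d.i, d.p'⟩
  have b3 := hw ⟨d.j, d.q⟩
  have b4 := hw ⟨d.j, d.q'⟩
  rw [Fin.val_ofNat, Fin.val_ofNat, Nat.mod_eq_of_lt (by omega), Nat.mod_eq_of_lt (by omega)] at h3
  have h4 := ht (Set.mem_Iio.2 (by omega)) (Set.mem_Iio.2 (by omega)) h3
  exact hd (by omega)

/-! ### Structures without unbalanced contacts -/

theorem Touch.symm {A : RelStruct I δ} {i j : I} {p : Fin (δ i)} {q : Fin (δ j)}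
    (h : Touch A i p j q) : Touch A j q i p := by
  obtain ⟨e, he, e', he', h⟩ := h
  exact ⟨e', he', e, he, h.symm⟩

/-- Offsets that separate positions of the same kind and whose nonzero differences separate
distinct kinds. -/
structure IsSeparating (w : (Σ i, Fin (δ i)) → ℕ) : Prop where
  injective : ∀ i p q, w ⟨i, p⟩ = w ⟨i, q⟩ → p = q
  cross : ∀ i j p p' q q', i ≠ j → w ⟨i, p⟩ + w ⟨j, q'⟩ = w ⟨j, q⟩ + w ⟨i, p'⟩ →
    p = p' ∧ q = q'

theorem exists_isSeparating [Finite I] (hI : Nat.card I ≤ 2) :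
    ∃ w : (Σ i, Fin (δ i)) → ℕ, IsSeparating w := by
  obtain ⟨B, hB⟩ := (Set.finite_range δ).bddAbove
  have hB : ∀ i, δ i ≤ B := fun i => hB ⟨i, rfl⟩
  let u : I → ℕ := fun i => Finite.equivFin I i
  have hu : ∀ i, u i < 2 := fun i => (Finite.equivFin I i).2.trans_le hI
  have huinj : ∀ i j, u i = u j → i = j := fun i j h =>
    (Finite.equivFin I).injective (Fin.ext h)
  have key : ∀ a a' b b' : ℕ, a < B → a' < B → a + B * b' = B * b + a' → a = a' ∧ b = b' := by
    intro a a' b b' ha ha' h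
    have hmod := congrArg (· % B) h
    simp only [Nat.add_mul_mod_self_left, Nat.mul_add_mod_self_left, Nat.mod_eq_of_lt ha,
      Nat.mod_eq_of_lt ha'] at hmod
    refine ⟨hmod, Nat.eq_of_mul_eq_mul_left (ha.pos) ?_⟩
    omega
  refine ⟨fun a => B ^ u a.1 * a.2, fun i p q h => ?_, fun i j p p' q q' hij h => ?_⟩
  · have hpos : 0 < B ^ u i := pow_pos (p.pos.trans_le (hB i)) _
    exact Fin.ext (Nat.eq_of_mul_eq_mul_left hpos h)
  · have hp := p.2.trans_le (hB i)
    have hp' := p'.2.trans_le (hB i)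
    have hq := q.2.trans_le (hB j)
    have hq' := q'.2.trans_le (hB j)
    have hne : u i ≠ u j := fun h => hij (huinj i j h)
    have hi := hu i
    have hj := hu j
    simp only at h
    rcases (by omega : u i = 0 ∧ u j = 1 ∨ u i = 1 ∧ u j = 0) with ⟨h1, h2⟩ | ⟨h1, h2⟩
    · rw [h1, h2, pow_zero, pow_one, one_mul, one_mul] at h
      obtain ⟨h3, h4⟩ := key _ _ _ _ hp hp' h
      exact ⟨Fin.ext h3, Fin.ext h4⟩
    · rw [h1, h2, pow_zero, pow_one, one_mul, one_mul] at h
      obtain ⟨h3, h4⟩ := key q q' p p' hq hq' (by omega)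
      exact ⟨Fin.ext h4, Fin.ext h3⟩

/-- No unbalanced datum occurs in the structure. -/
def IsPoor (w : (Σ i, Fin (δ i)) → ℕ) (A : RelStruct I δ) : Prop :=
  ∀ d : Datum δ, d.IsUnbalanced w → ¬ d.OccursIn A

theorem IsPoor.eq_of_touch {w : (Σ i, Fin (δ i)) → ℕ} {A : RelStruct I δ} (hA : IsPoor w A)
    (hw : IsSeparating w) {i : I} {p q : Fin (δ i)} (h : Touch A i p i q) : p = q := by
  by_contra hpq
  refine hA ⟨i, i, p, q, q, p⟩ (fun hbal => hpq (hw.injective i p q ?_)) ⟨h, h.symm⟩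
  simp only at hbal
  omega

theorem IsPoor.eq_of_touch_of_touch {w : (Σ i, Fin (δ i)) → ℕ} {A : RelStruct I δ}
    (hA : IsPoor w A) (hw : IsSeparating w) {i j : I} (hij : i ≠ j) {p p' : Fin (δ i)}
    {q q' : Fin (δ j)} (h : Touch A i p j q) (h' : Touch A i p' j q') : p = p' ∧ q = q' := by
  by_contra hne
  exact hA ⟨i, j, p, p', q, q'⟩ (fun hbal => hne (hw.cross i j p p' q q' hij hbal)) ⟨h, h'⟩

/-- In a poor structure one can select an edge of each available kind so that all contacts are
realised by the selected edges. -/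
theorem IsPoor.exists_edges [Finite I] (hI : Nat.card I ≤ 2) {w : (Σ i, Fin (δ i)) → ℕ}
    (hw : IsSeparating w) {A : RelStruct I δ} (hA : IsPoor w A) :
    ∃ E : ∀ i, Fin (δ i) → A.carrier, (∀ i, (A.rel i).Nonempty → E i ∈ A.rel i) ∧
      ∀ i p j q, Touch A i p j q → E i p = E j q := by
  classical
  have hE₀ : ∀ i, ∃ e : Fin (δ i) → A.carrier, (A.rel i).Nonempty → e ∈ A.rel i := by
    intro i
    by_cases h : (A.rel i).Nonempty
    · exact ⟨h.some, fun _ => h.some_mem⟩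
    · exact ⟨fun _ => A.nonempty.some, fun h' => absurd h' h⟩
  choose E₀ hE₀ using hE₀
  by_cases hcross : ∃ i j, i ≠ j ∧ ∃ p q, Touch A i p j q
  · obtain ⟨i₀, j₀, hij, p₀, q₀, ht⟩ := hcross
    obtain ⟨e, he, e', he', hee'⟩ := id ht
    have hall : ∀ i, i = i₀ ∨ i = j₀ := by
      have := Fintype.ofFinite I
      intro i
      by_contra! hi
      have hcard : ({i, i₀, j₀} : Finset I).card = 3 :=
        Finset.card_eq_three.2 ⟨i, i₀, j₀, hi.1, hi.2, hij, rfl⟩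
      have := Finset.card_le_univ ({i, i₀, j₀} : Finset I)
      rw [Nat.card_eq_fintype_card] at hI
      omega
    have hEi : Function.update (Function.update E₀ j₀ e') i₀ e i₀ = e := by simp
    have hEj : Function.update (Function.update E₀ j₀ e') i₀ e j₀ = e' := by
      rw [Function.update_of_ne hij.symm, Function.update_self]
    refine ⟨Function.update (Function.update E₀ j₀ e') i₀ e, fun i _ => ?_,
      fun i p j q h => ?_⟩
    · rcases hall i with rfl | rfl
      · rwa [hEi]
      · rwa [hEj]
    · by_cases hne : i = j
      · subst hne
        rw [hA.eq_of_touch hw h]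
      · rcases hall i with rfl | rfl <;> rcases hall j with rfl | rfl
        · exact absurd rfl hne
        · obtain ⟨rfl, rfl⟩ := hA.eq_of_touch_of_touch hw hij h ht
          rw [hEi, hEj, hee']
        · obtain ⟨rfl, rfl⟩ := hA.eq_of_touch_of_touch hw hij h.symm ht
          rw [hEi, hEj, hee']
        · exact absurd rfl hne
  · push Not at hcross
    refine ⟨E₀, hE₀, fun i p j q h => ?_⟩
    by_cases hne : i = j
    · subst hne
      rw [hA.eq_of_touch hw h]
    · exact absurd h (hcross i j hne p q)

theorem IsPoor.homTo_of_touch [Finite I] (hδ : ∀ i, 2 ≤ δ i) (hI : Nat.card I ≤ 2)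
    {w : (Σ i, Fin (δ i)) → ℕ} (hw : IsSeparating w) {A B : RelStruct I δ} (hB : IsPoor w B)
    (hAB : ∀ i p j q, Touch A i p j q → Touch B i p j q) : HomTo A B := by
  classical
  obtain ⟨E, hE, hEt⟩ := hB.exists_edges hI hw
  have hex : ∀ v : A.carrier, ∃ b : B.carrier, ∀ i, ∀ e ∈ A.rel i, ∀ p, e p = v → b = E i p := by
    intro v
    by_cases h : ∃ i, ∃ e ∈ A.rel i, ∃ p, e p = v
    · obtain ⟨i, e, he, p, rfl⟩ := h
      exact ⟨E i p, fun j e' he' q hq => hEt _ _ _ _ (hAB _ _ _ _ ⟨e, he, e', he', hq.symm⟩)⟩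
    · push Not at h
      exact ⟨B.nonempty.some, fun i e he p hp => absurd hp (h i e he p)⟩
  choose f hf using hex
  refine ⟨f, fun i e he => ?_⟩
  have heq : f ∘ e = E i := funext fun p => hf _ i e he p rfl
  rw [heq]
  have p : Fin (δ i) := ⟨0, by have := hδ i; omega⟩
  obtain ⟨e', he', -⟩ := hAB i p i p ⟨e, he, e, he, rfl⟩
  exact hE i ⟨e', he'⟩

/-- Up to homomorphic equivalence there are only finitely many poor structures. -/
theorem exists_finite_isPoor_representatives [Finite I] (hδ : ∀ i, 2 ≤ δ i)
    (hI : Nat.card I ≤ 2) {w : (Σ i, Fin (δ i)) → ℕ} (hw : IsSeparating w) :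
    ∃ L : Set (RelStruct I δ), L.Finite ∧ ∀ A, IsPoor w A → ∃ B ∈ L, HomEquiv A B := by
  let T : RelStruct I δ → (Σ i, Fin (δ i)) → (Σ i, Fin (δ i)) → Prop :=
    fun A a b => Touch A a.1 a.2 b.1 b.2
  choose rep hrep using fun t : T '' {A | IsPoor w A} => t.2
  refine ⟨Set.range rep, Set.finite_range rep, fun A hA => ?_⟩
  obtain ⟨hpoor, hT⟩ := hrep ⟨T A, A, hA, rfl⟩
  have hT : ∀ i p j q, Touch (rep ⟨T A, A, hA, rfl⟩) i p j q ↔ Touch A i p j q :=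
    fun i p j q => Iff.of_eq (congrFun (congrFun hT ⟨i, p⟩) ⟨j, q⟩)
  exact ⟨_, ⟨_, rfl⟩, hpoor.homTo_of_touch hδ hI hw fun i p j q => (hT i p j q).2,
    IsPoor.homTo_of_touch hδ hI hw hA fun i p j q => (hT i p j q).1⟩

/-! ### From finite maximal antichains to finite dualities -/

theorem homTo_sum_left (A B : RelStruct I δ) : HomTo A (A.sum B) :=
  ⟨Sum.inl, fun _ e he => Or.inl ⟨e, he, rfl⟩⟩

theorem homTo_sum_right (A B : RelStruct I δ) : HomTo B (A.sum B) :=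
  ⟨Sum.inr, fun _ e he => Or.inr ⟨e, he, rfl⟩⟩

theorem prod_homTo_left (A B : RelStruct I δ) : HomTo (A.prod B) A :=
  ⟨Prod.fst, fun _ _ he => he.1⟩

theorem prod_homTo_right (A B : RelStruct I δ) : HomTo (A.prod B) B :=
  ⟨Prod.snd, fun _ _ he => he.2⟩

theorem exists_finiteDuality_of_isMaxAntichain [Finite I] (hδ : ∀ i, 2 ≤ δ i)
    (hI : Nat.card I ≤ 2) {Q : Set (RelStruct I δ)} (hfin : Q.Finite) (hQ : IsMaxAntichain Q) :
    ∃ F D : Set (RelStruct I δ), FiniteDuality F D ∧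
      Q = F ∪ {d ∈ D | ∀ f ∈ F, ¬ HomTo d f} := by
  obtain ⟨w, hw⟩ := exists_isSeparating (δ := δ) hI
  obtain ⟨M, hM⟩ := (Set.finite_range w).bddAbove
  have hM : ∀ a, w a ≤ M := fun a => hM ⟨a, rfl⟩
  obtain ⟨N, hN⟩ := (hfin.image fun A : RelStruct I δ => Nat.card A.carrier).bddAbove
  have hN : ∀ A ∈ Q, Nat.card A.carrier < N + 1 := fun A hA =>
    Nat.lt_succ_of_le (hN ⟨A, hA, rfl⟩)
  obtain ⟨L, hL, hLpoor⟩ := exists_finite_isPoor_representatives hδ hI hw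
  refine hQ.exists_finiteDuality
    (Q' := {A ∈ Q | ∃ d : Datum δ, d.IsUnbalanced w ∧ HomTo (ladder (N + 1) d) A})
    hfin (Set.sep_subset _ _) hL (fun X hX => ?_) (fun X f hf hXf => ?_)
  · obtain ⟨n, hn⟩ := exists_prod_shift_not_homTo hM hfin hX
    obtain ⟨A, hA, h | h⟩ := hQ.2.2 (X.prod (shift w M n))
    · exact absurd h (hn A hA)
    · refine ⟨A, ⟨hA, fun ⟨_, d, hd, hdA⟩ => ?_⟩, h.trans (prod_homTo_left _ _)⟩
      exact not_homTo_ladder_shift hM hδ hd N.succ_pos n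
        ((hdA.trans h).trans (prod_homTo_right _ _))
  · by_cases hpoor : IsPoor w X
    · exact Or.inr (hLpoor X hpoor)
    · unfold IsPoor at hpoor
      push Not at hpoor
      obtain ⟨d, hd, hdX⟩ := hpoor
      obtain ⟨A, hA, h | h⟩ := hQ.2.2 (X.sum (ladder (N + 1) d))
      · exact Or.inl ⟨A, ⟨hA, d, hd, (homTo_sum_right _ _).trans h⟩,
          (homTo_sum_left _ _).trans h⟩
      · have hAX := homTo_of_homTo_sum_ladder (hN A hA) hdX h
        obtain rfl := hQ.eq_of_homTo hA hf.1 (hAX.trans hXf.1)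
        exact absurd hAX hXf.2

end RelStruct

end ThesisFormal

open ThesisFormal RelStruct in
/-- If the index set `I` has at most two elements, then the
finite maximal antichains in the homomorphism order are exactly the sets
`Q = ℱ ∪ {D ∈ 𝒟 : D ↛ F for every F ∈ ℱ}` where `(ℱ, 𝒟)` ranges over all
finite homomorphism dualities. -/
theorem stmt_17 {I : Type} [Finite I] {δ : I → ℕ} (hδ : ∀ i, 2 ≤ δ i)
    (hI : Nat.card I ≤ 2) (Q : Set (RelStruct I δ)) :
    (Q.Finite ∧ IsMaxAntichain Q) ↔
      ∃ F D : Set (RelStruct I δ), FiniteDuality F D ∧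
        Q = F ∪ {d ∈ D | ∀ f ∈ F, ¬ HomTo d f} := by
  constructor
  · rintro ⟨hfin, hQ⟩
    exact exists_finiteDuality_of_isMaxAntichain hδ hI hfin hQ
  · rintro ⟨F, D, h, rfl⟩
    exact isMaxAntichain_of_finiteDuality h
end

section
/- Let L be a distributive lattice and let f, d ∈ L form a duality pair, i.e. for every x ∈ L one has f ≤ x if and only if x ≰ d. Then f is connected: whenever f = b ∨ c for some b, c ∈ L, then f = b or f = c. -/
/-- In a distributive lattice, if `(f, d)` is a duality pair
(`f ≤ x ↔ ¬ x ≤ d` for every `x`), then `f` is connected: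
`f = b ⊔ c` implies `f = b` or `f = c`. -/
theorem stmt_18 {L : Type*} [DistribLattice L] (f d : L)
    (hdual : ∀ x : L, f ≤ x ↔ ¬ x ≤ d) (b c : L) (h : f = b ⊔ c) :
    f = b ∨ f = c := by
  have hfd : ¬ f ≤ d := (hdual f).1 le_rfl
  by_cases hb : b ≤ d
  · have hc : ¬ c ≤ d := fun hc => hfd (h.trans_le (sup_le hb hc))
    exact Or.inr (((hdual c).2 hc).antisymm (le_sup_right.trans_eq h.symm))
  · exact Or.inl (((hdual b).2 hb).antisymm (le_sup_left.trans_eq h.symm))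
end
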